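/- Let F, G be symmetric probability measures on E^N, and let Z ∼ G, Y ∼ F. Then the normalized Wasserstein distance between F and G equals the expected Wasserstein distance between the empirical measures under an optimal coupling: W₁(G, F) = inf over couplings π of E_π[ W₁(μ^N_Z, μ^N_Y) ], where W₁ on E^N uses the normalized cost (1/N) Σᵢ |xᵢ - yᵢ| ∧ 1 (weaker direction: W₁(G,F) ≥ inf_π E_π[W₁(μ^N_Z, μ^N_Y)] holds since the normalized cost dominates the transport cost between the associated empirical measures). -/

import Mathlib

open MeasureTheory
open scoped BigOperators ENNReal

/-- The Kantorovich (Wasserstein-1) distance for the truncated cost `d ∧ 1`. -/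
noncomputable def W1 {E : Type*} [MeasurableSpace E] [PseudoMetricSpace E]
    (μ ν : Measure E) : ℝ :=
  sInf { r | ∃ π : Measure (E × E), π.map Prod.fst = μ ∧ π.map Prod.snd = ν ∧
    r = ∫ p, min (dist p.1 p.2) 1 ∂π }

/-- The normalized MKW distance on `E^N`, with cost `(1/N) Σᵢ (d(xᵢ,yᵢ) ∧ 1)`. -/
noncomputable def W1N {E : Type*} [MeasurableSpace E] [PseudoMetricSpace E]
    {N : ℕ} (F G : Measure (Fin N → E)) : ℝ :=
  sInf { r | ∃ π : Measure ((Fin N → E) × (Fin N → E)),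
    π.map Prod.fst = F ∧ π.map Prod.snd = G ∧
    r = ∫ p, (1 / (N : ℝ)) * ∑ i, min (dist (p.1 i) (p.2 i)) 1 ∂π }

/-- The empirical measure `μ^N_V = (1/N) Σᵢ δ_{vᵢ}`. -/
noncomputable def empMeas {E : Type*} [MeasurableSpace E] {N : ℕ}
    (V : Fin N → E) : Measure E :=
  ((N : ℝ≥0∞))⁻¹ • ∑ i, Measure.dirac (V i)

/-- The normalized truncated cost `(1/N) Σᵢ (d(xᵢ,yᵢ) ∧ 1)`. -/
noncomputable def normCost {E : Type*} [PseudoMetricSpace E] {N : ℕ} (x y : Fin N → E) : ℝ :=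
  (1 / (N : ℝ)) * ∑ i, min (dist (x i) (y i)) 1

/-- The density, with respect to the empirical measure of `V`, of the share of the atom at `V i`
which is attributed to the index `i` when every atom is split evenly between its indices. -/
noncomputable def atomWeight {E : Type*} {N : ℕ} (V : Fin N → E) (i : Fin N) : E → ℝ :=
  open Classical in Set.indicator {V i} fun _ => ((Finset.univ.filter fun k => V k = V i).card : ℝ)⁻¹

section Assignment

variable {ι : Type*} [Fintype ι] [DecidableEq ι]

/-- The cost of a doubly stochastic transport plan is at least that of the best permutation. -/
theorem exists_perm_sum_le_of_mem_doublyStochastic {M : Matrix ι ι ℝ}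
    (hM : M ∈ doublyStochastic ℝ ι) (c : ι → ι → ℝ) :
    ∃ σ : Equiv.Perm ι, ∑ i, c i (σ i) ≤ ∑ i, ∑ j, M i j * c i j := by
  obtain ⟨w, hw0, hw1, rfl⟩ := exists_eq_sum_perm_of_mem_doublyStochastic hM
  obtain ⟨σ₀, hσ₀⟩ := Finite.exists_min fun σ : Equiv.Perm ι => ∑ i, c i (σ i)
  refine ⟨σ₀, ?_⟩
  calc ∑ i, c i (σ₀ i) = ∑ σ, w σ * ∑ i, c i (σ₀ i) := by rw [← Finset.sum_mul, hw1, one_mul]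
    _ ≤ ∑ σ, w σ * ∑ i, c i (σ i) :=
      Finset.sum_le_sum fun σ _ => mul_le_mul_of_nonneg_left (hσ₀ σ) (hw0 σ)
    _ = ∑ i, ∑ σ, w σ * c i (σ i) := by
      simp_rw [Finset.mul_sum]
      exact Finset.sum_comm
    _ = _ := by
      refine Finset.sum_congr rfl fun i _ => ?_
      simp_rw [Matrix.sum_apply, Finset.sum_mul]
      rw [Finset.sum_comm]
      refine Finset.sum_congr rfl fun σ _ => ?_
      simp [PEquiv.toMatrix_apply, Matrix.smul_apply]

end Assignment

/-- A finite family of measurable real functions has a measurable selection of minimizers. -/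
theorem exists_measurable_argmin {α ι : Type*} [MeasurableSpace α] [MeasurableSpace ι]
    [Finite ι] [Nonempty ι] {f : ι → α → ℝ} (hf : ∀ i, Measurable (f i)) :
    ∃ s : α → ι, Measurable s ∧ ∀ a i, f (s a) a ≤ f i a := by
  classical
  obtain ⟨g, hg⟩ := exists_surjective_nat ι
  have hex : ∀ a, ∃ n, ∀ i, f (g n) a ≤ f i a := fun a => by
    obtain ⟨i₀, hi₀⟩ := Finite.exists_min fun i => f i a
    obtain ⟨n, rfl⟩ := hg i₀
    exact ⟨n, hi₀⟩
  refine ⟨fun a => g (Nat.find (hex a)), ?_, fun a => Nat.find_spec (hex a)⟩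
  refine (measurable_from_top (f := g)).comp (measurable_find hex fun n => ?_)
  simp only [Set.ofPred_forall]
  exact MeasurableSet.iInter fun i => measurableSet_le (hf _) (hf i)

section AtomWeight

variable {E : Type*} {N : ℕ} (V : Fin N → E)

theorem atomWeight_nonneg (i : Fin N) (u : E) : 0 ≤ atomWeight V i u :=
  Set.indicator_nonneg (fun _ _ => by positivity) u

theorem eq_of_atomWeight_ne_zero {i : Fin N} {u : E} (h : atomWeight V i u ≠ 0) : u = V i :=
  Set.mem_singleton_iff.1 (Set.mem_of_indicator_ne_zero (s := {V i}) h)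

theorem atomWeight_le_one (i : Fin N) (u : E) : atomWeight V i u ≤ 1 := by
  classical
  refine Set.indicator_le' (fun _ _ => ?_) (fun _ _ => zero_le_one) u
  exact Nat.cast_inv_le_one _

theorem sum_atomWeight_index (k : Fin N) : ∑ i, atomWeight V i (V k) = 1 := by
  classical
  have h : ∀ i, atomWeight V i (V k) =
      if V i = V k then ((Finset.univ.filter fun l => V l = V k).card : ℝ)⁻¹ else 0 := fun i => by
    by_cases hi : V i = V k
    · simp [atomWeight, hi]
    · simp [atomWeight, hi, Ne.symm hi]
  simp_rw [h]
  rw [← Finset.sum_filter, Finset.sum_const, nsmul_eq_mul, mul_inv_cancel₀]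
  exact Nat.cast_ne_zero.2 (Finset.card_ne_zero_of_mem (a := k) (by simp))

theorem sum_atomWeight_atom (i : Fin N) : ∑ k, atomWeight V i (V k) = 1 := by
  classical
  simp_rw [atomWeight, Set.indicator_apply, Set.mem_singleton_iff]
  rw [← Finset.sum_filter, Finset.sum_const, nsmul_eq_mul, mul_inv_cancel₀]
  exact Nat.cast_ne_zero.2 (Finset.card_ne_zero_of_mem (a := i) (by simp))

theorem measurable_atomWeight [MeasurableSpace E] [MeasurableSingletonClass E] (i : Fin N) :
    Measurable (atomWeight V i) :=
  measurable_const.indicator (measurableSet_singleton _)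

end AtomWeight

section EmpiricalMeasure

variable {E E' : Type*} [MeasurableSpace E] [MeasurableSpace E'] {N : ℕ}

theorem map_empMeas {f : E → E'} (hf : Measurable f) (V : Fin N → E) :
    (empMeas V).map f = empMeas fun i => f (V i) := by
  simp [empMeas, Measure.map_smul, Measure.map_finset_sum hf.aemeasurable, Measure.map_dirac' hf]

theorem empMeas_comp_perm (V : Fin N → E) (σ : Equiv.Perm (Fin N)) :
    (empMeas fun i => V (σ i)) = empMeas V := by
  simp only [empMeas]
  rw [Equiv.sum_comp σ fun i => Measure.dirac (V i)]

theorem isProbabilityMeasure_empMeas (hN : 1 ≤ N) (V : Fin N → E) :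
    IsProbabilityMeasure (empMeas V) := by
  refine ⟨?_⟩
  have : (N : ℝ≥0∞) ≠ 0 := by exact_mod_cast (by omega : N ≠ 0)
  simp [empMeas, ENNReal.inv_mul_cancel this]

theorem integral_empMeas [MeasurableSingletonClass E] (V : Fin N → E) (f : E → ℝ) :
    ∫ u, f u ∂empMeas V = (1 / (N : ℝ)) * ∑ i, f (V i) := by
  rw [empMeas, integral_smul_measure, integral_finsetSum_measure]
  · simp
  · exact fun i _ => integrable_dirac (by simp)

theorem ae_empMeas_mem_range [MeasurableSingletonClass E] (V : Fin N → E) :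
    ∀ᵐ u ∂empMeas V, ∃ k, u = V k := by
  have hs : MeasurableSet {u | ∃ k, u = V k} := by
    have : {u | ∃ k, u = V k} = Set.range V := by
      ext u
      simp [eq_comm]
    rw [this]
    exact (Set.finite_range V).measurableSet
  rw [ae_iff, empMeas]
  simp

end EmpiricalMeasure

theorem isProbabilityMeasure_of_map {α β : Type*} [MeasurableSpace α] [MeasurableSpace β]
    {π : Measure α} {f : α → β} {μ : Measure β} [IsProbabilityMeasure μ] (hf : Measurable f)
    (h : π.map f = μ) : IsProbabilityMeasure π :=
  ⟨by rw [← Set.preimage_univ (f := f), ← Measure.map_apply hf MeasurableSet.univ, h, measure_univ]⟩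

theorem W1_nonneg {E : Type*} [MeasurableSpace E] [PseudoMetricSpace E] (μ ν : Measure E) :
    0 ≤ W1 μ ν := by
  refine Real.sInf_nonneg ?_
  rintro r ⟨π, -, -, rfl⟩
  exact integral_nonneg fun p => le_min dist_nonneg zero_le_one

section Cost

variable {E : Type*} [PseudoMetricSpace E] {N : ℕ}

theorem normCost_nonneg (x y : Fin N → E) : 0 ≤ normCost x y := by
  unfold normCost
  positivity

theorem normCost_le_one (x y : Fin N → E) : normCost x y ≤ 1 := by
  have h : ∑ i : Fin N, min (dist (x i) (y i)) 1 ≤ ∑ _i : Fin N, (1 : ℝ) :=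
    Finset.sum_le_sum fun i _ => min_le_right _ _
  rw [Finset.sum_const, Finset.card_univ, Fintype.card_fin, nsmul_eq_mul, mul_one] at h
  unfold normCost
  calc _ ≤ (1 / (N : ℝ)) * N := by gcongr
    _ ≤ 1 := by rw [one_div]; exact inv_mul_le_one

theorem normCost_comp_perm (x y : Fin N → E) (σ : Equiv.Perm (Fin N)) :
    normCost (fun i => x (σ i)) (fun i => y (σ i)) = normCost x y := by
  unfold normCost
  rw [Equiv.sum_comp σ fun i => min (dist (x i) (y i)) 1]

variable [MeasurableSpace E] [BorelSpace E] [SecondCountableTopology E]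

theorem measurable_normCost {α : Type*} [MeasurableSpace α] {f g : α → Fin N → E}
    (hf : Measurable f) (hg : Measurable g) : Measurable fun a => normCost (f a) (g a) := by
  unfold normCost
  refine Measurable.const_mul (Finset.measurable_sum _ fun i _ => Measurable.min ?_ measurable_const) _
  exact ((measurable_pi_apply i).comp hf).dist ((measurable_pi_apply i).comp hg)

end Cost

section MetricSpace

variable {E : Type*} [MetricSpace E] [MeasurableSpace E] [BorelSpace E]
  [SecondCountableTopology E] {N : ℕ}

/-- A coupling of two empirical measures costs at least as much as some matching of the atoms. -/
theorem exists_perm_normCost_le_integral (hN : 1 ≤ N) (x y : Fin N → E)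
    {π : Measure (E × E)} (h₁ : π.map Prod.fst = empMeas x) (h₂ : π.map Prod.snd = empMeas y) :
    ∃ σ : Equiv.Perm (Fin N),
      normCost x (fun i => y (σ i)) ≤ ∫ p, min (dist p.1 p.2) 1 ∂π := by
  have := isProbabilityMeasure_empMeas hN x
  have := isProbabilityMeasure_of_map measurable_fst h₁
  have hN0 : (N : ℝ) ≠ 0 := by exact_mod_cast (by omega : N ≠ 0)
  have hx : ∀ᵐ p ∂π, ∃ k, p.1 = x k :=
    ae_of_ae_map measurable_fst.aemeasurable (h₁ ▸ ae_empMeas_mem_range x)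
  have hy : ∀ᵐ p ∂π, ∃ k, p.2 = y k :=
    ae_of_ae_map measurable_snd.aemeasurable (h₂ ▸ ae_empMeas_mem_range y)
  have hint : ∀ i j, Integrable (fun p : E × E => atomWeight x i p.1 * atomWeight y j p.2) π := by
    intro i j
    refine Integrable.of_bound (C := 1) (((measurable_atomWeight x i).comp measurable_fst).mul
      ((measurable_atomWeight y j).comp measurable_snd)).aestronglyMeasurable
      (.of_forall fun p => ?_)
    rw [Real.norm_of_nonneg (mul_nonneg (atomWeight_nonneg ..) (atomWeight_nonneg ..))]
    exact mul_le_one₀ (atomWeight_le_one ..) (atomWeight_nonneg ..) (atomWeight_le_one ..)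
  let M : Matrix (Fin N) (Fin N) ℝ :=
    fun i j => N * ∫ p, atomWeight x i p.1 * atomWeight y j p.2 ∂π
  have hM : M ∈ doublyStochastic ℝ (Fin N) := by
    refine mem_doublyStochastic_iff_sum.2 ⟨fun i j => ?_, fun i => ?_, fun j => ?_⟩
    · exact mul_nonneg (Nat.cast_nonneg _) (integral_nonneg fun p =>
        mul_nonneg (atomWeight_nonneg ..) (atomWeight_nonneg ..))
    · have h : ∫ p, ∑ j, atomWeight x i p.1 * atomWeight y j p.2 ∂π = 1 / (N : ℝ) := by
        calc _ = ∫ p, atomWeight x i p.1 ∂π := by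
              refine integral_congr_ae (hy.mono fun p ⟨k, hk⟩ => ?_)
              simp only
              rw [← Finset.mul_sum, hk, sum_atomWeight_index, mul_one]
          _ = ∫ u, atomWeight x i u ∂(π.map Prod.fst) :=
            (integral_map measurable_fst.aemeasurable
              (measurable_atomWeight x i).aestronglyMeasurable).symm
          _ = 1 / (N : ℝ) := by rw [h₁, integral_empMeas, sum_atomWeight_atom, mul_one]
      simp only [M]
      rw [← Finset.mul_sum, ← integral_finsetSum _ fun j _ => hint i j, h,
        mul_one_div_cancel hN0]
    · have h : ∫ p, ∑ i, atomWeight x i p.1 * atomWeight y j p.2 ∂π = 1 / (N : ℝ) := by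
        calc _ = ∫ p, atomWeight y j p.2 ∂π := by
              refine integral_congr_ae (hx.mono fun p ⟨k, hk⟩ => ?_)
              simp only
              rw [← Finset.sum_mul, hk, sum_atomWeight_index, one_mul]
          _ = ∫ u, atomWeight y j u ∂(π.map Prod.snd) :=
            (integral_map measurable_snd.aemeasurable
              (measurable_atomWeight y j).aestronglyMeasurable).symm
          _ = 1 / (N : ℝ) := by rw [h₂, integral_empMeas, sum_atomWeight_atom, mul_one]
      simp only [M]
      rw [← Finset.mul_sum, ← integral_finsetSum _ fun i _ => hint i j, h,
        mul_one_div_cancel hN0]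
  obtain ⟨σ, hσ⟩ := exists_perm_sum_le_of_mem_doublyStochastic hM
    fun i j => min (dist (x i) (y j)) 1
  refine ⟨σ, ?_⟩
  have hcost : ∑ i, ∑ j, M i j * min (dist (x i) (y j)) 1
      = N * ∫ p, min (dist p.1 p.2) 1 ∂π := by
    have hdist : ∀ p : E × E,
        ∑ i, ∑ j, atomWeight x i p.1 * atomWeight y j p.2 * min (dist (x i) (y j)) 1
        = (∑ i, atomWeight x i p.1) * (∑ j, atomWeight y j p.2) * min (dist p.1 p.2) 1 := by
      intro p
      rw [Finset.sum_mul_sum, Finset.sum_mul]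
      refine Finset.sum_congr rfl fun i _ => ?_
      rw [Finset.sum_mul]
      refine Finset.sum_congr rfl fun j _ => ?_
      by_cases hi : atomWeight x i p.1 = 0
      · simp [hi]
      by_cases hj : atomWeight y j p.2 = 0
      · simp [hj]
      rw [eq_of_atomWeight_ne_zero x hi, eq_of_atomWeight_ne_zero y hj]
    have hae : ∫ p, min (dist p.1 p.2) 1 ∂π = ∫ p, ∑ i, ∑ j,
        atomWeight x i p.1 * atomWeight y j p.2 * min (dist (x i) (y j)) 1 ∂π := by
      refine integral_congr_ae ?_
      filter_upwards [hx, hy] with p ⟨k, hk⟩ ⟨l, hl⟩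
      rw [hdist, hk, hl, sum_atomWeight_index, sum_atomWeight_index, one_mul, one_mul]
    rw [hae, integral_finsetSum _ fun i _ => integrable_finsetSum _ fun j _ =>
      (hint i j).mul_const _, Finset.mul_sum]
    refine Finset.sum_congr rfl fun i _ => ?_
    rw [integral_finsetSum _ fun j _ => (hint i j).mul_const _, Finset.mul_sum]
    refine Finset.sum_congr rfl fun j _ => ?_
    rw [integral_mul_const, mul_assoc]
  rw [hcost] at hσ
  calc normCost x (fun i => y (σ i)) ≤ (1 / (N : ℝ)) * (N * ∫ p, min (dist p.1 p.2) 1 ∂π) :=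
        mul_le_mul_of_nonneg_left hσ (by positivity)
    _ = _ := by rw [← mul_assoc, one_div_mul_cancel hN0, one_mul]

/-- Matching the atoms through a permutation gives an upper bound for the `W1` distance. -/
theorem W1_empMeas_le_normCost (x y : Fin N → E) (σ : Equiv.Perm (Fin N)) :
    W1 (empMeas x) (empMeas y) ≤ normCost x (fun i => y (σ i)) := by
  refine csInf_le ⟨0, ?_⟩ ⟨empMeas fun i => (x i, y (σ i)), ?_, ?_, ?_⟩
  · rintro r ⟨π, -, -, rfl⟩
    exact integral_nonneg fun p => le_min dist_nonneg zero_le_one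
  · exact map_empMeas measurable_fst _
  · rw [map_empMeas measurable_snd]
    exact empMeas_comp_perm y σ
  · rw [integral_empMeas]
    rfl

/-- If `σ` is an optimal matching, it computes the `W1` distance of the empirical measures. -/
theorem W1_empMeas_eq_normCost (hN : 1 ≤ N) {x y : Fin N → E} {σ : Equiv.Perm (Fin N)}
    (hσ : ∀ τ : Equiv.Perm (Fin N), normCost x (fun i => y (σ i)) ≤ normCost x (fun i => y (τ i))) :
    W1 (empMeas x) (empMeas y) = normCost x (fun i => y (σ i)) := by
  refine le_antisymm (W1_empMeas_le_normCost x y σ) (le_csInf ?_ ?_)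
  · exact ⟨_, empMeas fun i => (x i, y i), map_empMeas measurable_fst _,
      map_empMeas measurable_snd _, rfl⟩
  · rintro r ⟨π, h₁, h₂, rfl⟩
    obtain ⟨τ, hτ⟩ := exists_perm_normCost_le_integral hN x y h₁ h₂
    exact (hσ τ).trans hτ

theorem integrable_normCost {α : Type*} [MeasurableSpace α] {π : Measure α} [IsFiniteMeasure π]
    {f g : α → Fin N → E} (hf : Measurable f) (hg : Measurable g) :
    Integrable (fun a => normCost (f a) (g a)) π := by
  refine Integrable.of_bound (C := 1) (measurable_normCost hf hg).aestronglyMeasurable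
    (.of_forall fun a => ?_)
  rw [Real.norm_of_nonneg (normCost_nonneg ..)]
  exact normCost_le_one ..

/-- Optimal matchings of the atoms of two empirical measures can be chosen measurably. -/
theorem exists_measurable_optimal_perm (hN : 1 ≤ N) [MeasurableSpace (Equiv.Perm (Fin N))] :
    ∃ s : (Fin N → E) × (Fin N → E) → Equiv.Perm (Fin N), Measurable s ∧
      ∀ p : (Fin N → E) × (Fin N → E),
        W1 (empMeas p.1) (empMeas p.2) = normCost p.1 (fun i => p.2 (s p i)) := by
  obtain ⟨s, hs, hmin⟩ := exists_measurable_argmin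
    (f := fun (σ : Equiv.Perm (Fin N)) (p : (Fin N → E) × (Fin N → E)) =>
      normCost p.1 (fun i => p.2 (σ i)))
    (fun σ => measurable_normCost measurable_fst (by fun_prop))
  exact ⟨s, hs, fun p => W1_empMeas_eq_normCost hN (hmin p)⟩

/-- Averaging over simultaneous permutations of the coordinates, a coupling of symmetric measures
can be rearranged into one whose normalized cost is the expected `W1` distance between the
empirical measures. -/
theorem exists_coupling_integral_normCost_eq (hN : 1 ≤ N) {F G : Measure (Fin N → E)}
    [IsProbabilityMeasure G]
    (hFsym : ∀ σ : Equiv.Perm (Fin N),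
      Measure.map (fun V : Fin N → E => fun i => V (σ i)) F = F)
    (hGsym : ∀ σ : Equiv.Perm (Fin N),
      Measure.map (fun V : Fin N → E => fun i => V (σ i)) G = G)
    {π : Measure ((Fin N → E) × (Fin N → E))}
    (h₁ : π.map Prod.fst = G) (h₂ : π.map Prod.snd = F) :
    ∃ π' : Measure ((Fin N → E) × (Fin N → E)), π'.map Prod.fst = G ∧ π'.map Prod.snd = F ∧
      ∫ p, normCost p.1 p.2 ∂π' = ∫ p, W1 (empMeas p.1) (empMeas p.2) ∂π := by
  have := isProbabilityMeasure_of_map measurable_fst h₁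
  let _ : MeasurableSpace (Equiv.Perm (Fin N)) := ⊤
  have : MeasurableSingletonClass (Equiv.Perm (Fin N)) := ⟨fun _ => trivial⟩
  obtain ⟨s, hs, hopt⟩ := exists_measurable_optimal_perm (E := E) hN
  let act : Equiv.Perm (Fin N) → (Fin N → E) → (Fin N → E) := fun σ V i => V (σ i)
  have hact : ∀ σ, Measurable (act σ) := fun σ => by fun_prop
  have hactm : ∀ τ, Measurable fun p : (Fin N → E) × (Fin N → E) => act (s p * τ) p.2 := fun τ => by
    have h : Measurable fun q : (Fin N → E) × Equiv.Perm (Fin N) => act (q.2 * τ) q.1 :=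
      measurable_from_prod_countable_left fun σ => hact (σ * τ)
    exact h.comp (measurable_snd.prodMk hs)
  let Φ : Equiv.Perm (Fin N) → (Fin N → E) × (Fin N → E) → (Fin N → E) × (Fin N → E) :=
    fun τ p => (act τ p.1, act (s p * τ) p.2)
  have hΦ : ∀ τ, Measurable (Φ τ) := fun τ => ((hact τ).comp measurable_fst).prodMk (hactm τ)
  let n : ℝ≥0∞ := (Fintype.card (Equiv.Perm (Fin N)) : ℝ≥0∞)
  have hn0 : n ≠ 0 := by simp [n]
  have hnt : n ≠ ∞ := ENNReal.natCast_ne_top _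
  have havg : ∀ μ : Measure (Fin N → E), n⁻¹ • ∑ _τ : Equiv.Perm (Fin N), μ = μ := fun μ => by
    rw [Finset.sum_const, Finset.card_univ, ← Nat.cast_smul_eq_nsmul ℝ≥0∞, smul_smul,
      ENNReal.inv_mul_cancel hn0 hnt, one_smul]
  refine ⟨n⁻¹ • ∑ τ, π.map (Φ τ), ?_, ?_, ?_⟩
  · rw [Measure.map_smul, Measure.map_finset_sum measurable_fst.aemeasurable]
    conv_rhs => rw [← havg G]
    congr 1
    refine Finset.sum_congr rfl fun τ _ => ?_
    rw [Measure.map_map measurable_fst (hΦ τ)]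
    conv_rhs => rw [← hGsym τ, ← h₁, Measure.map_map (hact τ) measurable_fst]
    rfl
  · rw [Measure.map_smul, Measure.map_finset_sum measurable_snd.aemeasurable]
    conv_rhs => rw [← havg F]
    congr 1
    have hF : ∑ _τ : Equiv.Perm (Fin N), F = ∑ τ, π.map (fun p => act τ p.2) :=
      Finset.sum_congr rfl fun τ _ => by
        conv_lhs => rw [← hFsym τ, ← h₂, Measure.map_map (hact τ) measurable_snd]
        rfl
    rw [hF]
    ext A hA
    have hind : ∀ {f : (Fin N → E) × (Fin N → E) → Fin N → E}, Measurable f →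
        π.map f A = ∫⁻ p, A.indicator 1 (f p) ∂π := fun {f} hf => by
      rw [← lintegral_map (measurable_one.indicator hA) hf, lintegral_indicator_one hA]
    have hmap : ∀ τ, (π.map (Φ τ)).map Prod.snd = π.map fun p => act (s p * τ) p.2 := fun τ =>
      Measure.map_map measurable_snd (hΦ τ)
    have hmap' : ∀ τ, ((π.map (Φ τ)).map Prod.snd) A
        = ∫⁻ p, A.indicator 1 (act (s p * τ) p.2) ∂π := fun τ => by
      rw [hmap, hind (hactm τ)]
    have hmap'' : ∀ τ, (π.map fun p => act τ p.2) A = ∫⁻ p, A.indicator 1 (act τ p.2) ∂π :=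
      fun τ => hind ((hact τ).comp measurable_snd)
    simp_rw [Measure.finsetSum_apply, hmap', hmap'']
    refine (lintegral_finsetSum _ fun τ _ =>
      (measurable_one.indicator hA).comp (hactm τ)).symm.trans (Eq.trans ?_ (lintegral_finsetSum _
        fun τ _ => (measurable_one.indicator hA).comp ((hact τ).comp measurable_snd)))
    refine lintegral_congr fun p => ?_
    exact Equiv.sum_comp (Equiv.mulLeft (s p)) fun τ => A.indicator (1 : (Fin N → E) → ℝ≥0∞) (act τ p.2)
  · have hτ : ∀ τ, ∫ p, normCost p.1 p.2 ∂(π.map (Φ τ))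
        = ∫ p, W1 (empMeas p.1) (empMeas p.2) ∂π := fun τ => by
      rw [integral_map (hΦ τ).aemeasurable
        (measurable_normCost measurable_fst measurable_snd).aestronglyMeasurable]
      refine integral_congr_ae (.of_forall fun p => ?_)
      exact (normCost_comp_perm p.1 (fun i => p.2 (s p i)) τ).trans (hopt p).symm
    have : ∀ τ, IsFiniteMeasure (π.map (Φ τ)) := fun τ => inferInstance
    rw [integral_smul_measure, integral_finsetSum_measure fun τ _ =>
      integrable_normCost measurable_fst measurable_snd]
    simp_rw [hτ]
    rw [Finset.sum_const, Finset.card_univ, nsmul_eq_mul, smul_eq_mul, ← mul_assoc,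
      ENNReal.toReal_inv]
    simp [n]

/-- The expected `W1` distance between empirical measures is at most the normalized cost. -/
theorem integral_W1_empMeas_le {π : Measure ((Fin N → E) × (Fin N → E))}
    [IsFiniteMeasure π] :
    ∫ p, W1 (empMeas p.1) (empMeas p.2) ∂π ≤ ∫ p, normCost p.1 p.2 ∂π := by
  exact integral_mono_of_nonneg (.of_forall fun p => W1_nonneg _ _)
    (integrable_normCost measurable_fst measurable_snd)
    (.of_forall fun p => W1_empMeas_le_normCost p.1 p.2 1)

end MetricSpace

/-- For symmetric probability measures `F, G` on `E^N`, the normalized MKW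
distance between `G` and `F` equals the infimum over couplings of the expected
`W₁` distance between the associated empirical measures. -/
theorem W1N_eq_inf_expected_W1_empirical
    {E : Type*} [MetricSpace E] [MeasurableSpace E] [BorelSpace E]
    [SecondCountableTopology E] {N : ℕ} (hN : 1 ≤ N)
    (F G : Measure (Fin N → E)) [IsProbabilityMeasure F] [IsProbabilityMeasure G]
    (hFsym : ∀ σ : Equiv.Perm (Fin N),
      Measure.map (fun V : Fin N → E => fun i => V (σ i)) F = F)
    (hGsym : ∀ σ : Equiv.Perm (Fin N),
      Measure.map (fun V : Fin N → E => fun i => V (σ i)) G = G) :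
    W1N G F = sInf { r | ∃ π : Measure ((Fin N → E) × (Fin N → E)),
      π.map Prod.fst = G ∧ π.map Prod.snd = F ∧
      r = ∫ p, W1 (empMeas p.1) (empMeas p.2) ∂π } := by
  have hprod : (G.prod F).map Prod.fst = G ∧ (G.prod F).map Prod.snd = F := by
    constructor
    · exact Measure.fst_prod
    · exact Measure.snd_prod
  refine le_antisymm (le_csInf ⟨_, G.prod F, hprod.1, hprod.2, rfl⟩ ?_)
    (le_csInf ⟨_, G.prod F, hprod.1, hprod.2, rfl⟩ ?_)
  · rintro r ⟨π, h₁, h₂, rfl⟩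
    obtain ⟨π', h₁', h₂', h⟩ := exists_coupling_integral_normCost_eq hN hFsym hGsym h₁ h₂
    refine csInf_le ⟨0, ?_⟩ ⟨π', h₁', h₂', h.symm⟩
    rintro r ⟨π, -, -, rfl⟩
    exact integral_nonneg fun p => normCost_nonneg p.1 p.2
  · rintro r ⟨π, h₁, h₂, rfl⟩
    have := isProbabilityMeasure_of_map measurable_fst h₁
    refine le_trans (csInf_le ⟨0, ?_⟩ ⟨π, h₁, h₂, rfl⟩) integral_W1_empMeas_le
    rintro r ⟨π, -, -, rfl⟩
    exact integral_nonneg fun p => W1_nonneg _ _
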